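/- Let n ≥ 2 and p ≥ 2. Let f : ℝ^{n+1}\{0} → (0,∞) be a positive C¹ function homogeneous of degree −p, and let u : ℝ^{n+1}\{0} → (0,∞) be a positive C² function homogeneous of degree 1 satisfying Δu = f u^{p−1} on ℝ^{n+1}\{0}. Then sup_{x ∈ S^n} |∇_{S^n} u(x)| / u(x) ≤ (n/(n−1)) · ( sup_{x ∈ S^n} |∇_{S^n} f(x)| ) / ( inf_{S^n} f ), where for a differentiable function g the tangential (spherical) gradient at x ∈ S^n is ∇_{S^n} g(x) = ∇g(x) − ⟨∇g(x), x⟩ x. -/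

import Mathlib

open MeasureTheory Metric Set
open scoped RealInnerProductSpace

/-- The Euclidean Laplacian of `u : ℝ^m → ℝ`, as the sum of second partial
derivatives along the standard coordinate directions. -/
noncomputable def laplacian {m : ℕ} (u : EuclideanSpace ℝ (Fin m) → ℝ)
    (x : EuclideanSpace ℝ (Fin m)) : ℝ :=
  ∑ i, fderiv ℝ (fun y => fderiv ℝ u y (EuclideanSpace.single i 1)) x (EuclideanSpace.single i 1)

/-- The tangential (spherical) gradient `∇_{Sⁿ} g(x) = ∇g(x) - ⟨∇g(x), x⟩ x`. -/
noncomputable def sphereGrad {m : ℕ} (g : EuclideanSpace ℝ (Fin m) → ℝ)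
    (x : EuclideanSpace ℝ (Fin m)) : EuclideanSpace ℝ (Fin m) :=
  gradient g x - ⟪gradient g x, x⟫ • x

open Filter Topology

section SecondVariation

variable {E : Type*} [NormedAddCommGroup E] [NormedSpace ℝ E]

/-- The second derivative is nonpositive at a local maximum. -/
lemma IsLocalMax.second_deriv_nonpos {h k : ℝ → ℝ} {k' t₀ : ℝ} (hmax : IsLocalMax h t₀)
    (hd : ∀ᶠ t in 𝓝 t₀, HasDerivAt h (k t) t) (hk : HasDerivAt k k' t₀) : k' ≤ 0 := by
  by_contra! hpos
  have hderiv : deriv h =ᶠ[𝓝 t₀] k := hd.mono fun t ht => ht.deriv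
  have hmin : IsLocalMin h t₀ := by
    refine isLocalMin_of_deriv_deriv_pos ?_ hmax.deriv_eq_zero hd.self_of_nhds.continuousAt
    rw [hderiv.deriv_eq, hk.deriv]
    exact hpos
  have hconst : h =ᶠ[𝓝 t₀] fun _ => h t₀ := by
    filter_upwards [hmax, hmin] with t h1 h2 using le_antisymm h1 h2
  have hzero : k =ᶠ[𝓝 t₀] fun _ => 0 := by
    filter_upwards [hconst.eventuallyEq_nhds, hderiv] with t h1 h2
    rw [← h2, h1.deriv_eq, deriv_const]
  have := hzero.deriv_eq
  rw [hk.deriv, deriv_const] at this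
  exact hpos.ne' this

/-- The curve `t ↦ cos t • p + sin t • q + r`. -/
noncomputable def ellipticArc (p q r : E) (t : ℝ) : E := Real.cos t • p + Real.sin t • q + r

lemma ellipticArc_zero (p q r : E) : ellipticArc p q r 0 = p + r := by simp [ellipticArc]

lemma hasDerivAt_ellipticArc (p q r : E) (t : ℝ) :
    HasDerivAt (ellipticArc p q r) (-Real.sin t • p + Real.cos t • q) t :=
  (((Real.hasDerivAt_cos t).smul_const p).add ((Real.hasDerivAt_sin t).smul_const q)).add_const r

lemma eventually_ellipticArc_ne_zero {p q r : E} (h : p + r ≠ 0) :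
    ∀ᶠ t in 𝓝 (0 : ℝ), ellipticArc p q r t ≠ 0 := by
  apply (hasDerivAt_ellipticArc p q r 0).continuousAt.eventually_ne
  rwa [ellipticArc_zero]

variable {g : E → ℝ}

lemma ContDiffOn.differentiableAt_compl_zero {k : WithTop ℕ∞} (hg : ContDiffOn ℝ k g {0}ᶜ)
    (hk : k ≠ 0) {y : E} (hy : y ≠ 0) : DifferentiableAt ℝ g y :=
  (hg.differentiableOn hk).differentiableAt (isOpen_compl_singleton.mem_nhds hy)

lemma ContDiffOn.differentiableAt_fderiv_compl_zero (hg : ContDiffOn ℝ 2 g {0}ᶜ)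
    {y : E} (hy : y ≠ 0) : DifferentiableAt ℝ (fderiv ℝ g) y :=
  ((hg.fderiv_of_isOpen (m := 1) isOpen_compl_singleton (by norm_num)).differentiableOn
    one_ne_zero).differentiableAt (isOpen_compl_singleton.mem_nhds hy)

lemma hasDerivAt_comp_ellipticArc {p q r : E} {t : ℝ}
    (hg : DifferentiableAt ℝ g (ellipticArc p q r t)) :
    HasDerivAt (fun t => g (ellipticArc p q r t))
      (fderiv ℝ g (ellipticArc p q r t) (-Real.sin t • p + Real.cos t • q)) t :=
  hg.hasFDerivAt.comp_hasDerivAt t (hasDerivAt_ellipticArc p q r t)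

lemma hasDerivAt_fderiv_ellipticArc (hg : ContDiffOn ℝ 2 g {0}ᶜ) {p q r : E} (h : p + r ≠ 0) :
    HasDerivAt
      (fun t => fderiv ℝ g (ellipticArc p q r t) (-Real.sin t • p + Real.cos t • q))
      (fderiv ℝ (fderiv ℝ g) (p + r) q q - fderiv ℝ g (p + r) p) 0 := by
  have h1 : HasDerivAt (fun t => fderiv ℝ g (ellipticArc p q r t))
      (fderiv ℝ (fderiv ℝ g) (p + r) q) 0 := by
    have hd := hg.differentiableAt_fderiv_compl_zero h
    rw [← ellipticArc_zero p q r] at hd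
    exact (hd.hasFDerivAt.comp_hasDerivAt 0 (hasDerivAt_ellipticArc p q r 0)).congr_deriv
      (by simp [ellipticArc_zero])
  have h2 : HasDerivAt (fun t => -Real.sin t • p + Real.cos t • q) (-p) 0 := by
    exact (((Real.hasDerivAt_sin 0).neg.smul_const p).add
      ((Real.hasDerivAt_cos 0).smul_const q)).congr_deriv (by simp)
  have := h1.clm_apply h2
  simpa [ellipticArc_zero, sub_eq_add_neg] using this

lemma IsLocalMax.second_variation (hg : ContDiffOn ℝ 2 g {0}ᶜ) {p q r : E} (h : p + r ≠ 0)
    (hmax : IsLocalMax (fun t => g (ellipticArc p q r t)) 0) :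
    fderiv ℝ (fderiv ℝ g) (p + r) q q ≤ fderiv ℝ g (p + r) p := by
  have := hmax.second_deriv_nonpos ((eventually_ellipticArc_ne_zero h).mono fun t ht =>
    hasDerivAt_comp_ellipticArc (hg.differentiableAt_compl_zero two_ne_zero ht))
    (hasDerivAt_fderiv_ellipticArc hg h)
  linarith

lemma IsLocalMax.first_variation_sub (hg : ContDiffOn ℝ 2 g {0}ᶜ) {p q r p' q' r' : E}
    (h : p + r ≠ 0) (h' : p' + r' ≠ 0)
    (hmax : IsLocalMax (fun t => g (ellipticArc p q r t) - g (ellipticArc p' q' r' t)) 0) :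
    fderiv ℝ g (p + r) q = fderiv ℝ g (p' + r') q' := by
  have d1 := hasDerivAt_comp_ellipticArc (p := p) (q := q) (r := r) (t := 0) (g := g)
    (hg.differentiableAt_compl_zero two_ne_zero (by rwa [ellipticArc_zero]))
  have d2 := hasDerivAt_comp_ellipticArc (p := p') (q := q') (r := r') (t := 0) (g := g)
    (hg.differentiableAt_compl_zero two_ne_zero (by rwa [ellipticArc_zero]))
  have := hmax.hasDerivAt_eq_zero (d1.sub d2)
  simp only [ellipticArc_zero, Real.sin_zero, Real.cos_zero, neg_zero, zero_smul, one_smul,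
    zero_add] at this
  linarith

lemma IsLocalMax.second_variation_sub (hg : ContDiffOn ℝ 2 g {0}ᶜ) {p q r p' q' r' : E}
    (h : p + r ≠ 0) (h' : p' + r' ≠ 0)
    (hmax : IsLocalMax (fun t => g (ellipticArc p q r t) - g (ellipticArc p' q' r' t)) 0) :
    fderiv ℝ (fderiv ℝ g) (p + r) q q - fderiv ℝ g (p + r) p ≤
      fderiv ℝ (fderiv ℝ g) (p' + r') q' q' - fderiv ℝ g (p' + r') p' := by
  have hd : ∀ᶠ t in 𝓝 (0 : ℝ), HasDerivAt
      (fun t => g (ellipticArc p q r t) - g (ellipticArc p' q' r' t))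
      (fderiv ℝ g (ellipticArc p q r t) (-Real.sin t • p + Real.cos t • q) -
        fderiv ℝ g (ellipticArc p' q' r' t) (-Real.sin t • p' + Real.cos t • q')) t := by
    filter_upwards [eventually_ellipticArc_ne_zero h, eventually_ellipticArc_ne_zero h']
      with t ht ht'
    exact (hasDerivAt_comp_ellipticArc (hg.differentiableAt_compl_zero two_ne_zero ht)).sub
      (hasDerivAt_comp_ellipticArc (hg.differentiableAt_compl_zero two_ne_zero ht'))
  have := hmax.second_deriv_nonpos hd
    ((hasDerivAt_fderiv_ellipticArc hg h).sub (hasDerivAt_fderiv_ellipticArc hg h'))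
  linarith

end SecondVariation

section Homogeneous

variable {E : Type*} [NormedAddCommGroup E] [NormedSpace ℝ E] {u : E → ℝ}

lemma fderiv_apply_self_of_homogeneous
    (hu : ∀ t : ℝ, 0 < t → ∀ y : E, y ≠ 0 → u (t • y) = t * u y) {y : E} (hy : y ≠ 0)
    (hd : DifferentiableAt ℝ u y) : fderiv ℝ u y y = u y := by
  have h1 : HasDerivAt (fun t : ℝ => u (t • y)) (fderiv ℝ u y y) 1 := by
    rw [← one_smul ℝ y] at hd
    exact (hd.hasFDerivAt.comp_hasDerivAt (1 : ℝ)
      ((hasDerivAt_id (1 : ℝ)).smul_const y)).congr_deriv (by simp)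
  have h2 : HasDerivAt (fun t : ℝ => t * u y) (u y) 1 := by
    simpa using (hasDerivAt_id (1 : ℝ)).mul_const (u y)
  refine h1.unique (h2.congr_of_eventuallyEq ?_)
  filter_upwards [lt_mem_nhds (zero_lt_one (α := ℝ))] with t ht using hu t ht y hy

lemma fderiv_fderiv_apply_self_of_homogeneous
    (hu : ∀ t : ℝ, 0 < t → ∀ y : E, y ≠ 0 → u (t • y) = t * u y)
    (hC : ContDiffOn ℝ 2 u {0}ᶜ) {y : E} (hy : y ≠ 0) :
    fderiv ℝ (fderiv ℝ u) y y y = 0 := by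
  have h1 : HasDerivAt (fun t : ℝ => fderiv ℝ u (t • y) (t • y))
      (fderiv ℝ (fderiv ℝ u) y y y + fderiv ℝ u y y) 1 := by
    have hd := hC.differentiableAt_fderiv_compl_zero hy
    rw [← one_smul ℝ y] at hd
    have hs : HasDerivAt (fun t : ℝ => t • y) y 1 := by
      simpa using (hasDerivAt_id (1 : ℝ)).smul_const y
    have hs' : HasDerivAt (fun t : ℝ => fderiv ℝ u (t • y)) (fderiv ℝ (fderiv ℝ u) y y) 1 :=
      (hd.hasFDerivAt.comp_hasDerivAt (1 : ℝ) hs).congr_deriv (by rw [one_smul])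
    exact (hs'.clm_apply hs).congr_deriv (by simp)
  have h2 : HasDerivAt (fun t : ℝ => t * u y) (u y) 1 := by
    simpa using (hasDerivAt_id (1 : ℝ)).mul_const (u y)
  have h3 := h1.unique (h2.congr_of_eventuallyEq (by
    filter_upwards [lt_mem_nhds (zero_lt_one (α := ℝ))] with t ht
    have hty : t • y ≠ 0 := smul_ne_zero ht.ne' hy
    rw [fderiv_apply_self_of_homogeneous hu hty (hC.differentiableAt_compl_zero two_ne_zero hty),
      hu t ht y hy]))
  rw [fderiv_apply_self_of_homogeneous hu hy (hC.differentiableAt_compl_zero two_ne_zero hy)] at h3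
  linarith

lemma fderiv_log_apply {y : E} (hd : DifferentiableAt ℝ u y) (h0 : u y ≠ 0) (v : E) :
    fderiv ℝ (fun z => Real.log (u z)) y v = fderiv ℝ u y v / u y := by
  rw [(hd.hasFDerivAt.log h0).fderiv]
  simp [div_eq_inv_mul]

lemma fderiv_fderiv_log_apply (hC : ContDiffOn ℝ 2 u {0}ᶜ) (hpos : ∀ y, y ≠ 0 → 0 < u y)
    {y : E} (hy : y ≠ 0) (v : E) :
    fderiv ℝ (fderiv ℝ fun z => Real.log (u z)) y v v =
      fderiv ℝ (fderiv ℝ u) y v v / u y - (fderiv ℝ u y v / u y) ^ 2 := by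
  have h0 := (hpos y hy).ne'
  have hd := hC.differentiableAt_compl_zero two_ne_zero hy
  have heq : (fderiv ℝ fun z => Real.log (u z)) =ᶠ[𝓝 y] fun z => (u z)⁻¹ • fderiv ℝ u z := by
    filter_upwards [isOpen_compl_singleton.mem_nhds hy] with z hz
    exact ((hC.differentiableAt_compl_zero two_ne_zero hz).hasFDerivAt.log (hpos z hz).ne').fderiv
  have hinv : HasFDerivAt (fun z => (u z)⁻¹) (-(u y ^ 2)⁻¹ • fderiv ℝ u y) y :=
    (hasDerivAt_inv h0).comp_hasFDerivAt y hd.hasFDerivAt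
  rw [heq.fderiv_eq,
    (hinv.fun_smul (hC.differentiableAt_fderiv_compl_zero hy).hasFDerivAt).fderiv]
  simp
  field_simp
  ring

end Homogeneous

section Euclidean

variable {m : ℕ} {u : EuclideanSpace ℝ (Fin m) → ℝ}

lemma laplacian_eq_sum_orthonormalBasis {y : EuclideanSpace ℝ (Fin m)}
    (hd : DifferentiableAt ℝ (fderiv ℝ u) y)
    (b : OrthonormalBasis (Fin m) ℝ (EuclideanSpace ℝ (Fin m))) :
    laplacian u y = ∑ i, fderiv ℝ (fderiv ℝ u) y (b i) (b i) := by
  have h1 : laplacian u y = Laplacian.laplacian u y := by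
    rw [InnerProductSpace.laplacian_eq_iteratedFDeriv_orthonormalBasis u
      (EuclideanSpace.basisFun (Fin m) ℝ)]
    refine Finset.sum_congr rfl fun i _ => ?_
    rw [iteratedFDeriv_two_apply, (hd.hasFDerivAt.clm_apply (hasFDerivAt_const _ _)).fderiv]
    simp
  rw [h1, InnerProductSpace.laplacian_eq_iteratedFDeriv_orthonormalBasis u b]
  simp [iteratedFDeriv_two_apply]

lemma fderiv_apply_le_norm_sphereGrad (g : EuclideanSpace ℝ (Fin m) → ℝ)
    {x v : EuclideanSpace ℝ (Fin m)} (hv : ‖v‖ = 1) (hxv : ⟪x, v⟫ = 0) :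
    |fderiv ℝ g x v| ≤ ‖sphereGrad g x‖ := by
  have : fderiv ℝ g x v = ⟪sphereGrad g x, v⟫ := by
    rw [sphereGrad, inner_sub_left, inner_smul_left, hxv, inner_gradient_left]
    simp
  rw [this]
  simpa [hv] using abs_real_inner_le_norm (sphereGrad g x) v

lemma continuousOn_sphereGrad {g : EuclideanSpace ℝ (Fin m) → ℝ}
    (hg : ContDiffOn ℝ 1 g {0}ᶜ) : ContinuousOn (sphereGrad g) {0}ᶜ := by
  have h1 : ContinuousOn (gradient g) {0}ᶜ :=
    (LinearIsometryEquiv.continuous _).comp_continuousOn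
      (hg.continuousOn_fderiv_of_isOpen isOpen_compl_singleton le_rfl)
  exact h1.sub ((h1.inner continuousOn_id).fun_smul continuousOn_id)

lemma inner_sphereGrad_self (g : EuclideanSpace ℝ (Fin m) → ℝ)
    {x : EuclideanSpace ℝ (Fin m)} (hx : ‖x‖ = 1) : ⟪sphereGrad g x, x⟫ = 0 := by
  simp [sphereGrad, inner_sub_left, inner_smul_left, hx]

lemma fderiv_apply_sphereGrad (g : EuclideanSpace ℝ (Fin m) → ℝ)
    {x : EuclideanSpace ℝ (Fin m)} (hx : ‖x‖ = 1) :
    fderiv ℝ g x (sphereGrad g x) = ‖sphereGrad g x‖ ^ 2 := by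
  rw [← real_inner_self_eq_norm_sq, ← inner_gradient_left]
  nth_rw 2 [sphereGrad]
  rw [inner_sub_left, inner_smul_left, real_inner_comm _ x, inner_sphereGrad_self g hx]
  simp

lemma sum_fderiv_log_sq {m : ℕ} {u : EuclideanSpace ℝ (Fin m) → ℝ}
    (hC : ContDiffOn ℝ 2 u {0}ᶜ) (hpos : ∀ y, y ≠ 0 → 0 < u y)
    {y : EuclideanSpace ℝ (Fin m)} (hy : y ≠ 0)
    (b : OrthonormalBasis (Fin m) ℝ (EuclideanSpace ℝ (Fin m))) :
    ∑ i, (fderiv ℝ (fderiv ℝ fun z => Real.log (u z)) y (b i) (b i) +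
      fderiv ℝ (fun z => Real.log (u z)) y (b i) ^ 2) = laplacian u y / u y := by
  rw [laplacian_eq_sum_orthonormalBasis (hC.differentiableAt_fderiv_compl_zero hy) b,
    Finset.sum_div]
  refine Finset.sum_congr rfl fun i _ => ?_
  rw [fderiv_fderiv_log_apply hC hpos hy,
    fderiv_log_apply (hC.differentiableAt_compl_zero two_ne_zero hy) (hpos y hy).ne']
  ring

lemma exists_orthonormalBasis_zero {k : ℕ} {m : EuclideanSpace ℝ (Fin (k + 1))} (hm : ‖m‖ = 1) :
    ∃ b : OrthonormalBasis (Fin (k + 1)) ℝ (EuclideanSpace ℝ (Fin (k + 1))), b 0 = m := by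
  have hv : Orthonormal ℝ (Set.domRestrict {(0 : Fin (k + 1))} fun _ => m) := by
    refine ⟨fun _ => hm, fun i j hij => absurd (Subsingleton.elim i j) hij⟩
  obtain ⟨b, hb⟩ := Orthonormal.exists_orthonormalBasis_extension_of_card_eq (by simp) hv
  exact ⟨b, hb 0 rfl⟩

lemma exists_orthonormalBasis_zero_one {k : ℕ} {m e : EuclideanSpace ℝ (Fin (k + 1 + 1))}
    (hm : ‖m‖ = 1) (he : ‖e‖ = 1) (hme : ⟪m, e⟫ = 0) :
    ∃ b : OrthonormalBasis (Fin (k + 1 + 1)) ℝ (EuclideanSpace ℝ (Fin (k + 1 + 1))),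
      b 0 = m ∧ b 1 = e := by
  have hv : Orthonormal ℝ (Set.domRestrict {(0 : Fin (k + 1 + 1)), 1}
      fun i => if i = 0 then m else e) := by
    refine ⟨?_, ?_⟩
    · rintro ⟨i, rfl | rfl⟩
      · simpa using hm
      · simpa using he
    · rintro ⟨i, rfl | rfl⟩ ⟨j, rfl | rfl⟩ hij
      · exact absurd rfl hij
      · simpa using hme
      · simpa [real_inner_comm] using hme
      · exact absurd rfl hij
  obtain ⟨b, hb⟩ := Orthonormal.exists_orthonormalBasis_extension_of_card_eq (by simp) hv
  refine ⟨b, ?_, ?_⟩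
  · simpa using hb 0 (by simp)
  · simpa using hb 1 (by simp)

end Euclidean

section OrthonormalPair

variable {E : Type*} [NormedAddCommGroup E] [InnerProductSpace ℝ E]

/-- Ordered pairs of orthonormal vectors. -/
def IsOrthonormalPair (m e : E) : Prop := ‖m‖ = 1 ∧ ‖e‖ = 1 ∧ ⟪m, e⟫ = 0

lemma IsOrthonormalPair.norm_comb {m e : E} (h : IsOrthonormalPair m e) {c s : ℝ}
    (hcs : c ^ 2 + s ^ 2 = 1) : ‖c • m + s • e‖ = 1 := by
  obtain ⟨hm, he, hme⟩ := h
  have : ‖c • m + s • e‖ ^ 2 = 1 := by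
    rw [norm_add_sq_real, norm_smul, norm_smul, inner_smul_left, inner_smul_right, hme, hm, he]
    simpa using hcs
  nlinarith [norm_nonneg (c • m + s • e)]

lemma IsOrthonormalPair.comb_ne_zero {m e : E} (h : IsOrthonormalPair m e) {c s : ℝ}
    (hcs : c ^ 2 + s ^ 2 = 1) : c • m + s • e ≠ 0 := by
  rw [← norm_ne_zero_iff, h.norm_comb hcs]
  exact one_ne_zero

lemma IsOrthonormalPair.norm_comb_sub {m e : E} (h : IsOrthonormalPair m e) {c s : ℝ}
    (hcs : c ^ 2 + s ^ 2 = 1) : ‖c • m - s • e‖ = 1 := by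
  rw [sub_eq_add_neg, ← neg_smul]
  exact h.norm_comb (by simpa using hcs)

lemma IsOrthonormalPair.comb_sub_ne_zero {m e : E} (h : IsOrthonormalPair m e) {c s : ℝ}
    (hcs : c ^ 2 + s ^ 2 = 1) : c • m - s • e ≠ 0 := by
  rw [← norm_ne_zero_iff, h.norm_comb_sub hcs]
  exact one_ne_zero

lemma IsOrthonormalPair.rotate {m e : E} (h : IsOrthonormalPair m e) {c s : ℝ}
    (hcs : c ^ 2 + s ^ 2 = 1) : IsOrthonormalPair (c • m + s • e) (-s • m + c • e) := by
  refine ⟨h.norm_comb hcs, h.norm_comb (by linarith [neg_sq s]), ?_⟩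
  obtain ⟨hm, he, hme⟩ := h
  simp only [inner_add_left, inner_add_right, inner_smul_left, inner_smul_right, hme,
    real_inner_comm m e, real_inner_self_eq_norm_sq, hm, he]
  simp
  ring

lemma IsOrthonormalPair.tilt {m e v : E} (h : IsOrthonormalPair m e) (hv : ‖v‖ = 1)
    (hmv : ⟪m, v⟫ = 0) (hve : ⟪v, e⟫ = 0) {c s : ℝ} (hcs : c ^ 2 + s ^ 2 = 1) :
    IsOrthonormalPair (c • m + s • v) e := by
  refine ⟨IsOrthonormalPair.norm_comb ⟨h.1, hv, hmv⟩ hcs, h.2.1, ?_⟩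
  simp [inner_add_left, inner_smul_left, h.2.2, hve]

end OrthonormalPair

/-- A second-variation inequality for a pair of points of the sphere that maximizes the difference
of `w` among all pairs of points at a fixed distance. -/
lemma second_variation_of_isMax_pair {k : ℕ} {w : EuclideanSpace ℝ (Fin (k + 1 + 1)) → ℝ}
    (hw : ContDiffOn ℝ 2 w {0}ᶜ) (hw1 : ∀ z, z ≠ 0 → fderiv ℝ w z z = 1)
    (hw2 : ∀ z, z ≠ 0 → fderiv ℝ (fderiv ℝ w) z z z = -1)
    {m e : EuclideanSpace ℝ (Fin (k + 1 + 1))} (hme : IsOrthonormalPair m e) {c s : ℝ}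
    (hcs : c ^ 2 + s ^ 2 = 1) (hc : 0 < c)
    (hmax : ∀ m' e', IsOrthonormalPair m' e' →
      w (c • m' + s • e') - w (c • m' - s • e') ≤ w (c • m + s • e) - w (c • m - s • e)) :
    ∃ b : OrthonormalBasis (Fin (k + 1 + 1)) ℝ (EuclideanSpace ℝ (Fin (k + 1 + 1))),
      c * (∑ i, (fderiv ℝ (fderiv ℝ w) (c • m + s • e) (b i) (b i) +
          fderiv ℝ w (c • m + s • e) (b i) ^ 2) -
        ∑ i, (fderiv ℝ (fderiv ℝ w) (c • m - s • e) (b i) (b i) +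
          fderiv ℝ w (c • m - s • e) (b i) ^ 2)) +
      k * (s * (fderiv ℝ w (c • m + s • e) (-s • m + c • e) +
        fderiv ℝ w (c • m - s • e) (s • m + c • e))) ≤ 0 := by
  obtain ⟨b, rfl, rfl⟩ := exists_orthonormalBasis_zero_one hme.1 hme.2.1 hme.2.2
  refine ⟨b, ?_⟩
  have hy := hme.comb_ne_zero hcs
  have hx := hme.comb_sub_ne_zero hcs
  have hmax1 : IsLocalMax (fun t =>
      w (ellipticArc (c • b 0 + s • b 1) (-s • b 0 + c • b 1) 0 t) -
      w (ellipticArc (c • b 0 - s • b 1) (s • b 0 + c • b 1) 0 t)) 0 := by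
    refine Eventually.of_forall fun t => ?_
    have e1 : ellipticArc (c • b 0 + s • b 1) (-s • b 0 + c • b 1) 0 t =
        c • (Real.cos t • b 0 + Real.sin t • b 1) + s • (-Real.sin t • b 0 + Real.cos t • b 1) := by
      simp only [ellipticArc]; module
    have e2 : ellipticArc (c • b 0 - s • b 1) (s • b 0 + c • b 1) 0 t =
        c • (Real.cos t • b 0 + Real.sin t • b 1) - s • (-Real.sin t • b 0 + Real.cos t • b 1) := by
      simp only [ellipticArc]; module
    simpa only [ellipticArc_zero, add_zero, e1, e2] using
      hmax _ _ (hme.rotate (Real.cos_sq_add_sin_sq t))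
  have hmax2 : ∀ i : Fin k, IsLocalMax (fun t =>
      w (ellipticArc (c • b 0) (c • b i.succ.succ) (s • b 1) t) -
      w (ellipticArc (c • b 0) (c • b i.succ.succ) (-(s • b 1)) t)) 0 := by
    intro i
    refine Eventually.of_forall fun t => ?_
    have hi := hme.tilt (b.norm_eq_one i.succ.succ)
      (b.inner_eq_zero (Fin.succ_ne_zero _).symm)
      (b.inner_eq_zero (by
        rw [← Fin.succ_zero_eq_one]
        exact fun h => Fin.succ_ne_zero _ (Fin.succ_injective _ h)))
      (Real.cos_sq_add_sin_sq t)
    have e1 : ellipticArc (c • b 0) (c • b i.succ.succ) (s • b 1) t =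
        c • (Real.cos t • b 0 + Real.sin t • b i.succ.succ) + s • b 1 := by
      simp only [ellipticArc]; module
    have e2 : ellipticArc (c • b 0) (c • b i.succ.succ) (-(s • b 1)) t =
        c • (Real.cos t • b 0 + Real.sin t • b i.succ.succ) - s • b 1 := by
      simp only [ellipticArc]; module
    simpa only [ellipticArc_zero, ← sub_eq_add_neg, e1, e2] using hmax _ _ hi
  have hy0 : c • b 0 + s • b 1 + 0 ≠ 0 := by rwa [add_zero]
  have hx0 : c • b 0 - s • b 1 + 0 ≠ 0 := by rwa [add_zero]
  have hx' : c • b 0 + -(s • b 1) ≠ 0 := by rwa [← sub_eq_add_neg]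
  have hτ1 := hmax1.first_variation_sub hw hy0 hx0
  have hτ2 := hmax1.second_variation_sub hw hy0 hx0
  have hi1 := fun i => (hmax2 i).first_variation_sub hw hy hx'
  have hi2 := fun i => (hmax2 i).second_variation_sub hw hy hx'
  have hy1 := hw1 _ hy
  have hx1 := hw1 _ hx
  have hy2 := hw2 _ hy
  have hx2 := hw2 _ hx
  simp only [add_zero, ← sub_eq_add_neg] at hτ1 hτ2 hi1 hi2
  rw [hy1, hx1] at hτ2
  generalize fderiv ℝ (fderiv ℝ w) (c • b 0 + s • b 1) = A at *
  generalize fderiv ℝ (fderiv ℝ w) (c • b 0 - s • b 1) = A' at *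
  generalize fderiv ℝ w (c • b 0 + s • b 1) = l at *
  generalize fderiv ℝ w (c • b 0 - s • b 1) = l' at *
  simp only [map_add, map_sub, map_smul, add_apply, sub_apply, smul_apply, smul_eq_mul] at *
  have hsq : ∀ i : Fin k, l (b i.succ.succ) = l' (b i.succ.succ) := fun i =>
    mul_left_cancel₀ hc.ne' (hi1 i)
  have hsum : c * (∑ i : Fin k, (A (b i.succ.succ) (b i.succ.succ) + l (b i.succ.succ) ^ 2) -
      ∑ i : Fin k, (A' (b i.succ.succ) (b i.succ.succ) + l' (b i.succ.succ) ^ 2)) ≤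
      k * (l (b 0) - l' (b 0)) := by
    rw [← Finset.sum_sub_distrib, Finset.mul_sum]
    calc _ ≤ ∑ i : Fin k, (l (b 0) - l' (b 0)) := by
          refine Finset.sum_le_sum fun i _ => ?_
          rw [hsq i]
          refine le_of_mul_le_mul_left ?_ hc
          linarith [hi2 i]
      _ = _ := by simp [mul_sub]
  simp only [Fin.sum_univ_succ (n := k + 1), Fin.sum_univ_succ (n := k), Fin.succ_zero_eq_one]
  have e1 : l (b 0) = c - s * (-s * l (b 0) + c * l (b 1)) := by
    linear_combination (-l (b 0)) * hcs + c * hy1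
  have e2 : l' (b 0) = c + s * (s * l' (b 0) + c * l' (b 1)) := by
    linear_combination (-l' (b 0)) * hcs + c * hx1
  have e3 : l (b 0) ^ 2 + l (b 1) ^ 2 = l' (b 0) ^ 2 + l' (b 1) ^ 2 := by
    have h1 : l (b 0) ^ 2 + l (b 1) ^ 2 = 1 + (-s * l (b 0) + c * l (b 1)) ^ 2 := by
      linear_combination (-(l (b 0) ^ 2 + l (b 1) ^ 2)) * hcs +
        (c * l (b 0) + s * l (b 1) + 1) * hy1
    have h2 : l' (b 0) ^ 2 + l' (b 1) ^ 2 = 1 + (s * l' (b 0) + c * l' (b 1)) ^ 2 := by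
      linear_combination (-(l' (b 0) ^ 2 + l' (b 1) ^ 2)) * hcs +
        (c * l' (b 0) - s * l' (b 1) + 1) * hx1
    rw [h1, h2, hτ1]
  have e4 : A (b 0) (b 0) + A (b 1) (b 1) ≤ A' (b 0) (b 0) + A' (b 1) (b 1) := by
    linear_combination hτ2 + hy2 - hx2 - (A (b 0) (b 0) + A (b 1) (b 1)) * hcs +
      (A' (b 0) (b 0) + A' (b 1) (b 1)) * hcs
  have e5 : (k : ℝ) * (l (b 0) - l' (b 0)) = -(k * (s * (-s * l (b 0) + c * l (b 1) +
      (s * l' (b 0) + c * l' (b 1))))) := by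
    linear_combination (k : ℝ) * e1 - (k : ℝ) * e2
  have e6 := mul_le_mul_of_nonneg_left e4 hc.le
  linear_combination hsum + e5 + e6 + c * e3

section TwoPointMaximum

variable {E : Type*} [NormedAddCommGroup E] [InnerProductSpace ℝ E]

lemma isCompact_orthonormalPair_angle [FiniteDimensional ℝ E] :
    IsCompact {q : E × E × ℝ | IsOrthonormalPair q.1 q.2.1 ∧ q.2.2 ∈ Icc 0 (Real.pi / 2)} := by
  refine ((isCompact_sphere (0 : E) 1).prod ((isCompact_sphere (0 : E) 1).prod
    (isCompact_Icc (a := (0 : ℝ)) (b := Real.pi / 2)))).of_isClosed_subset ?_ ?_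
  · refine IsClosed.inter (IsClosed.inter ?_ (IsClosed.inter ?_ ?_))
      (isClosed_Icc.preimage (by fun_prop : Continuous fun q : E × E × ℝ => q.2.2))
    all_goals exact isClosed_eq (by fun_prop) (by fun_prop)
  · rintro q ⟨⟨h1, h2, -⟩, h3⟩
    exact ⟨by simpa using h1, by simpa using h2, h3⟩

lemma exists_isMax_pair [FiniteDimensional ℝ E] {w : E → ℝ} (hw : ContDiffOn ℝ 2 w {0}ᶜ)
    {C : ℝ} (hC : 0 ≤ C) {x v : E} (hxv : IsOrthonormalPair x v) (hCx : C < fderiv ℝ w x v) :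
    ∃ m e : E, ∃ a : ℝ, IsOrthonormalPair m e ∧ 0 < a ∧ a < Real.pi / 2 ∧
      w (Real.cos a • m - Real.sin a • e) < w (Real.cos a • m + Real.sin a • e) ∧
      (∀ m' e', IsOrthonormalPair m' e' →
        w (Real.cos a • m' + Real.sin a • e') - w (Real.cos a • m' - Real.sin a • e') ≤
          w (Real.cos a • m + Real.sin a • e) - w (Real.cos a • m - Real.sin a • e)) ∧
      2 * C < fderiv ℝ w (Real.cos a • m + Real.sin a • e)
          (-Real.sin a • m + Real.cos a • e) +
        fderiv ℝ w (Real.cos a • m - Real.sin a • e) (Real.sin a • m + Real.cos a • e) := by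
  let Ψ : E × E × ℝ → ℝ := fun q => w (Real.cos q.2.2 • q.1 + Real.sin q.2.2 • q.2.1) -
    w (Real.cos q.2.2 • q.1 - Real.sin q.2.2 • q.2.1)
  let Φ : E × E × ℝ → ℝ := fun q => Real.cos q.2.2 * Ψ q - 2 * C * Real.sin q.2.2
  have hΨ : ∀ {m e : E}, IsOrthonormalPair m e → ∀ a : ℝ, HasDerivAt (fun a => Ψ (m, e, a))
      (fderiv ℝ w (Real.cos a • m + Real.sin a • e) (-Real.sin a • m + Real.cos a • e) +
        fderiv ℝ w (Real.cos a • m - Real.sin a • e) (Real.sin a • m + Real.cos a • e)) a := by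
    intro m e hme a
    have e1 : ∀ a, ellipticArc m e 0 a = Real.cos a • m + Real.sin a • e := fun a => by
      simp [ellipticArc]
    have e2 : ∀ a, ellipticArc m (-e) 0 a = Real.cos a • m - Real.sin a • e := fun a => by
      simp [ellipticArc, sub_eq_add_neg]
    have d1 := hasDerivAt_comp_ellipticArc (hw.differentiableAt_compl_zero two_ne_zero
      (by rw [e1]; exact hme.comb_ne_zero (Real.cos_sq_add_sin_sq a)) :
        DifferentiableAt ℝ w (ellipticArc m e 0 a))
    have d2 := hasDerivAt_comp_ellipticArc (hw.differentiableAt_compl_zero two_ne_zero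
      (by rw [e2]; exact hme.comb_sub_ne_zero (Real.cos_sq_add_sin_sq a)) :
        DifferentiableAt ℝ w (ellipticArc m (-e) 0 a))
    simp only [e1, e2] at d1 d2
    refine (d1.sub d2).congr_deriv ?_
    rw [sub_eq_add_neg, ← map_neg]
    congr 2
    module
  have hΦ : ∀ {m e : E}, IsOrthonormalPair m e → ∀ a : ℝ, HasDerivAt (fun a => Φ (m, e, a))
      (-Real.sin a * Ψ (m, e, a) + Real.cos a *
        (fderiv ℝ w (Real.cos a • m + Real.sin a • e) (-Real.sin a • m + Real.cos a • e) +
        fderiv ℝ w (Real.cos a • m - Real.sin a • e) (Real.sin a • m + Real.cos a • e)) -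
        2 * C * Real.cos a) a := fun hme a =>
    ((Real.hasDerivAt_cos a).mul (hΨ hme a)).sub ((Real.hasDerivAt_sin a).const_mul (2 * C))
  have hcont : ContinuousOn Φ
      {q : E × E × ℝ | IsOrthonormalPair q.1 q.2.1 ∧ q.2.2 ∈ Icc 0 (Real.pi / 2)} := by
    have hc1 : ContinuousOn (fun q : E × E × ℝ => w (Real.cos q.2.2 • q.1 + Real.sin q.2.2 • q.2.1))
        {q : E × E × ℝ | IsOrthonormalPair q.1 q.2.1 ∧ q.2.2 ∈ Icc 0 (Real.pi / 2)} :=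
      hw.continuousOn.comp (by fun_prop) fun q hq =>
        hq.1.comb_ne_zero (Real.cos_sq_add_sin_sq _)
    have hc2 : ContinuousOn (fun q : E × E × ℝ => w (Real.cos q.2.2 • q.1 - Real.sin q.2.2 • q.2.1))
        {q : E × E × ℝ | IsOrthonormalPair q.1 q.2.1 ∧ q.2.2 ∈ Icc 0 (Real.pi / 2)} :=
      hw.continuousOn.comp (by fun_prop) fun q hq =>
        hq.1.comb_sub_ne_zero (Real.cos_sq_add_sin_sq _)
    exact ContinuousOn.sub (ContinuousOn.mul (by fun_prop) (hc1.sub hc2)) (by fun_prop)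
  have hpi := Real.pi_pos
  obtain ⟨⟨m, e, a⟩, ⟨hme, ha0, ha1⟩, hmax⟩ := isCompact_orthonormalPair_angle.exists_isMaxOn
    ⟨(x, v, 0), hxv, le_rfl, by positivity⟩ hcont
  dsimp only at hme ha0 ha1
  have hpos : 0 < Φ (m, e, a) := by
    have hd := hΦ hxv 0
    simp only [Real.sin_zero, Real.cos_zero, neg_zero, zero_smul, one_smul, zero_mul, zero_add,
      add_zero, sub_zero, one_mul, mul_one] at hd
    have hslope := (hasDerivAt_iff_tendsto_slope.1 hd).mono_left
      (nhdsWithin_mono (0 : ℝ) fun t (ht : t ∈ Ioi (0 : ℝ)) => (mem_Ioi.1 ht).ne')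
    obtain ⟨t, ht, ht0, ht1⟩ := ((hslope.eventually (lt_mem_nhds
      (show 0 < fderiv ℝ w x v + fderiv ℝ w x v - 2 * C by linarith))).and
      (Ioo_mem_nhdsGT (show (0 : ℝ) < Real.pi / 2 by positivity))).exists
    have hΦ0 : Φ (x, v, 0) = 0 := by simp [Φ, Ψ]
    rw [slope_def_field, hΦ0, sub_zero, sub_zero] at ht
    have hle : Φ (x, v, t) ≤ Φ (m, e, a) := hmax ⟨hxv, ht0.le, ht1.le⟩
    exact lt_of_lt_of_le ((div_pos_iff_of_pos_right ht0).1 ht) hle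
  have ha0' : 0 < a := by
    refine lt_of_le_of_ne ha0 ?_
    rintro rfl
    simp [Φ, Ψ] at hpos
  have ha1' : a < Real.pi / 2 := by
    refine lt_of_le_of_ne ha1 ?_
    rintro rfl
    simp [Φ] at hpos
    linarith
  have hc : 0 < Real.cos a := Real.cos_pos_of_mem_Ioo ⟨by linarith, ha1'⟩
  have hs : 0 < Real.sin a := Real.sin_pos_of_pos_of_lt_pi ha0' (by linarith)
  have hΨpos : 0 < Ψ (m, e, a) := by
    have : 0 < Real.cos a * Ψ (m, e, a) := by
      have : 0 < Real.cos a * Ψ (m, e, a) - 2 * C * Real.sin a := hpos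
      nlinarith [mul_nonneg hC hs.le]
    exact (pos_iff_pos_of_mul_pos this).1 hc
  refine ⟨m, e, a, hme, ha0', ha1', sub_pos.1 hΨpos, fun m' e' h' => ?_, ?_⟩
  · have hle : Real.cos a * Ψ (m', e', a) - 2 * C * Real.sin a ≤
        Real.cos a * Ψ (m, e, a) - 2 * C * Real.sin a :=
      hmax (show (m', e', a) ∈ _ from ⟨h', ha0, ha1⟩)
    exact le_of_mul_le_mul_left (by linarith) hc
  · have hloc : IsLocalMax (fun a => Φ (m, e, a)) a := by
      filter_upwards [Icc_mem_nhds ha0' ha1'] with t ht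
      exact hmax (show (m, e, t) ∈ _ from ⟨hme, ht⟩)
    have h0 := hloc.hasDerivAt_eq_zero (hΦ hme a)
    refine lt_of_mul_lt_mul_left ?_ hc.le
    linarith [mul_pos hs hΨpos]

lemma abs_sub_le_of_orthonormalPair {f : E → ℝ} (hf : ContDiffOn ℝ 1 f {0}ᶜ) {S : ℝ}
    (hS : ∀ x v : E, IsOrthonormalPair x v → |fderiv ℝ f x v| ≤ S)
    {m e : E} (hme : IsOrthonormalPair m e) {a : ℝ} (ha : 0 ≤ a) :
    |f (Real.cos a • m + Real.sin a • e) - f (Real.cos a • m - Real.sin a • e)| ≤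
      S * (2 * a) := by
  have e1 : ∀ t, ellipticArc m e 0 t = Real.cos t • m + Real.sin t • e := fun t => by
    simp [ellipticArc]
  have hd : ∀ t, HasDerivAt (fun t => f (ellipticArc m e 0 t))
      (fderiv ℝ f (ellipticArc m e 0 t) (-Real.sin t • m + Real.cos t • e)) t := fun t =>
    hasDerivAt_comp_ellipticArc (hf.differentiableAt_compl_zero one_ne_zero
      (by rw [e1]; exact hme.comb_ne_zero (Real.cos_sq_add_sin_sq t)))
  have := convex_univ.norm_image_sub_le_of_norm_hasDerivWithin_le (x := -a) (y := a)
    (fun t _ => (hd t).hasDerivWithinAt)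
    (fun t _ => by
      rw [e1]
      exact hS _ _ (hme.rotate (Real.cos_sq_add_sin_sq t))) (mem_univ _) (mem_univ _)
  simp only [e1, Real.cos_neg, Real.sin_neg, neg_smul, ← sub_eq_add_neg] at this
  rwa [sub_neg_eq_add, ← two_mul, Real.norm_eq_abs, Real.norm_eq_abs,
    abs_of_nonneg (by positivity : 0 ≤ 2 * a)] at this

end TwoPointMaximum

lemma laplacian_le_of_isMaxOn_sphere {n : ℕ} {u : EuclideanSpace ℝ (Fin (n + 1)) → ℝ}
    (hC : ContDiffOn ℝ 2 u {0}ᶜ)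
    (hu : ∀ t : ℝ, 0 < t → ∀ y : EuclideanSpace ℝ (Fin (n + 1)), y ≠ 0 → u (t • y) = t * u y)
    {x : EuclideanSpace ℝ (Fin (n + 1))} (hx : ‖x‖ = 1) (hmax : IsMaxOn u (sphere 0 1) x) :
    laplacian u x ≤ n * u x := by
  have hx0 : x ≠ 0 := norm_ne_zero_iff.1 (by rw [hx]; exact one_ne_zero)
  obtain ⟨b, rfl⟩ := exists_orthonormalBasis_zero hx
  rw [laplacian_eq_sum_orthonormalBasis (hC.differentiableAt_fderiv_compl_zero hx0) b,
    Fin.sum_univ_succ, fderiv_fderiv_apply_self_of_homogeneous hu hC hx0, zero_add]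
  calc _ ≤ ∑ i : Fin n, u (b 0) := by
        refine Finset.sum_le_sum fun i _ => ?_
        have hpair : IsOrthonormalPair (b 0) (b i.succ) :=
          ⟨hx, b.norm_eq_one _, b.inner_eq_zero (Fin.succ_ne_zero i).symm⟩
        have hloc : IsLocalMax (fun t => u (ellipticArc (b 0) (b i.succ) 0 t)) 0 := by
          refine Eventually.of_forall fun t => ?_
          have := hmax (mem_sphere_zero_iff_norm.2 (hpair.norm_comb (Real.cos_sq_add_sin_sq t)))
          simpa [ellipticArc] using this
        have := hloc.second_variation hC (by rwa [add_zero])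
        rwa [add_zero, fderiv_apply_self_of_homogeneous hu hx0
          (hC.differentiableAt_compl_zero two_ne_zero hx0)] at this
    _ = _ := by simp

/-- gradient estimate for solutions of the `L_p` Christoffel equation. -/
theorem stmt_14 (n : ℕ) (hn : 2 ≤ n) (p : ℝ) (hp : 2 ≤ p)
    (f u : EuclideanSpace ℝ (Fin (n + 1)) → ℝ)
    (hf_pos : ∀ y : EuclideanSpace ℝ (Fin (n + 1)), y ≠ 0 → 0 < f y)
    (hf_C1 : ContDiffOn ℝ 1 f {(0 : EuclideanSpace ℝ (Fin (n + 1)))}ᶜ)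
    (hf_hom : ∀ t : ℝ, 0 < t → ∀ y : EuclideanSpace ℝ (Fin (n + 1)), y ≠ 0 →
      f (t • y) = t ^ (-p) * f y)
    (hu_pos : ∀ y : EuclideanSpace ℝ (Fin (n + 1)), y ≠ 0 → 0 < u y)
    (hu_C2 : ContDiffOn ℝ 2 u {(0 : EuclideanSpace ℝ (Fin (n + 1)))}ᶜ)
    (hu_hom : ∀ t : ℝ, 0 < t → ∀ y : EuclideanSpace ℝ (Fin (n + 1)), y ≠ 0 →
      u (t • y) = t * u y)
    (hu_lap : ∀ y : EuclideanSpace ℝ (Fin (n + 1)), y ≠ 0 →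
      laplacian u y = f y * u y ^ (p - 1)) :
    sSup ((fun x => ‖sphereGrad u x‖ / u x) '' sphere (0 : EuclideanSpace ℝ (Fin (n + 1))) 1) ≤
      (n / (n - 1)) *
        sSup ((fun x => ‖sphereGrad f x‖) '' sphere (0 : EuclideanSpace ℝ (Fin (n + 1))) 1) /
        sInf (f '' sphere (0 : EuclideanSpace ℝ (Fin (n + 1))) 1) := by
  obtain ⟨k, rfl⟩ : ∃ k, n = k + 1 := ⟨n - 1, by omega⟩
  have hk : (0 : ℝ) < k := by exact_mod_cast (by omega : 0 < k)
  have hcomp := isCompact_sphere (0 : EuclideanSpace ℝ (Fin (k + 1 + 1))) 1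
  have hne : (sphere (0 : EuclideanSpace ℝ (Fin (k + 1 + 1))) 1).Nonempty :=
    NormedSpace.sphere_nonempty.2 zero_le_one
  have hsub : sphere (0 : EuclideanSpace ℝ (Fin (k + 1 + 1))) 1 ⊆ {0}ᶜ := fun x hx =>
    ne_zero_of_mem_unit_sphere ⟨x, hx⟩
  set S := sSup ((fun x => ‖sphereGrad f x‖) ''
    sphere (0 : EuclideanSpace ℝ (Fin (k + 1 + 1))) 1) with hS_def
  have hS : ∀ x ∈ sphere (0 : EuclideanSpace ℝ (Fin (k + 1 + 1))) 1, ‖sphereGrad f x‖ ≤ S :=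
    fun x hx => le_csSup
      (hcomp.bddAbove_image ((continuousOn_sphereGrad hf_C1).mono hsub).norm) (mem_image_of_mem _ hx)
  have hS0 : 0 ≤ S := (norm_nonneg _).trans (hS _ hne.some_mem)
  obtain ⟨xf, hxf, hf_eq, hf_le⟩ := hcomp.exists_sInf_image_eq_and_le hne
    (hf_C1.continuousOn.mono hsub)
  rw [hf_eq]
  have hM : 0 < f xf := hf_pos _ (hsub hxf)
  have hbound : ∀ y ∈ sphere (0 : EuclideanSpace ℝ (Fin (k + 1 + 1))) 1,
      f xf * u y ^ (p - 2) ≤ k + 1 := by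
    intro y hy
    obtain ⟨x, hx, hmax⟩ := hcomp.exists_isMaxOn hne (hu_C2.continuousOn.mono hsub)
    have hux := hu_pos x (hsub hx)
    have hlap := laplacian_le_of_isMaxOn_sphere hu_C2 hu_hom (mem_sphere_zero_iff_norm.1 hx) hmax
    rw [hu_lap x (hsub hx), show p - 1 = p - 2 + 1 by ring, Real.rpow_add_one hux.ne',
      ← mul_assoc] at hlap
    push_cast at hlap
    calc f xf * u y ^ (p - 2) ≤ f x * u x ^ (p - 2) := by
          refine mul_le_mul (hf_le x hx) (Real.rpow_le_rpow (hu_pos y (hsub hy)).le (hmax hy)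
            (by linarith)) (Real.rpow_nonneg (hu_pos y (hsub hy)).le _) (hf_pos x (hsub hx)).le
      _ ≤ k + 1 := le_of_mul_le_mul_right hlap hux
  refine csSup_le (hne.image _) ?_
  rintro _ ⟨x, hx, rfl⟩
  by_contra! hlt
  push_cast at hlt
  rw [add_sub_cancel_right] at hlt
  set C : ℝ := (k + 1) / k * S / f xf with hC_def
  have hC0 : 0 ≤ C := by positivity
  have hCk : f xf * (k * C) = (k + 1) * S := by rw [hC_def]; field_simp
  have hx1 := mem_sphere_zero_iff_norm.1 hx
  have hux := hu_pos x (hsub hx)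
  have hw : ContDiffOn ℝ 2 (fun z => Real.log (u z)) {0}ᶜ :=
    hu_C2.log fun z hz => (hu_pos z hz).ne'
  have hdiff : ∀ z, z ≠ 0 → DifferentiableAt ℝ u z := fun z hz =>
    hu_C2.differentiableAt_compl_zero two_ne_zero hz
  have hw1 : ∀ z, z ≠ 0 → fderiv ℝ (fun z => Real.log (u z)) z z = 1 := fun z hz => by
    rw [fderiv_log_apply (hdiff z hz) (hu_pos z hz).ne',
      fderiv_apply_self_of_homogeneous hu_hom hz (hdiff z hz), div_self (hu_pos z hz).ne']
  have hw2 : ∀ z, z ≠ 0 → fderiv ℝ (fderiv ℝ fun z => Real.log (u z)) z z z = -1 :=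
    fun z hz => by
    rw [fderiv_fderiv_log_apply hu_C2 hu_pos hz,
      fderiv_fderiv_apply_self_of_homogeneous hu_hom hu_C2 hz,
      fderiv_apply_self_of_homogeneous hu_hom hz (hdiff z hz), div_self (hu_pos z hz).ne']
    norm_num
  have hG : 0 < ‖sphereGrad u x‖ := (div_pos_iff_of_pos_right hux).1 (hC0.trans_lt hlt)
  have hxv : IsOrthonormalPair x (‖sphereGrad u x‖⁻¹ • sphereGrad u x) := by
    refine ⟨hx1, ?_, ?_⟩
    · rw [norm_smul, norm_inv, norm_norm, inv_mul_cancel₀ hG.ne']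
    · rw [inner_smul_right, real_inner_comm, inner_sphereGrad_self u hx1, mul_zero]
  have hCx : C < fderiv ℝ (fun z => Real.log (u z)) x (‖sphereGrad u x‖⁻¹ • sphereGrad u x) := by
    rw [fderiv_log_apply (hdiff x (hsub hx)) hux.ne', map_smul, fderiv_apply_sphereGrad u hx1,
      smul_eq_mul, sq, inv_mul_cancel_left₀ hG.ne']
    exact hlt
  obtain ⟨m, e, a, hme, ha0, ha1, hlog, hmax, hderiv⟩ := exists_isMax_pair hw hC0 hxv hCx
  have hcs := Real.cos_sq_add_sin_sq a
  have hc : 0 < Real.cos a := Real.cos_pos_of_mem_Ioo ⟨by linarith, ha1⟩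
  have hs : 0 < Real.sin a := Real.sin_pos_of_pos_of_lt_pi ha0 (by linarith)
  obtain ⟨b, hb⟩ := second_variation_of_isMax_pair hw hw1 hw2 hme hcs hc hmax
  have hy1 := hme.comb_ne_zero hcs
  have hz1 := hme.comb_sub_ne_zero hcs
  have hfl := abs_sub_le_of_orthonormalPair hf_C1 (fun x v h =>
    (fderiv_apply_le_norm_sphereGrad f h.2.1 h.2.2).trans
      (hS x (mem_sphere_zero_iff_norm.2 h.1))) hme ha0.le
  have hby := hbound _ (mem_sphere_zero_iff_norm.2 (hme.norm_comb hcs))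
  rw [sum_fderiv_log_sq hu_C2 hu_pos hy1 b, sum_fderiv_log_sq hu_C2 hu_pos hz1 b, hu_lap _ hy1,
    hu_lap _ hz1] at hb
  generalize fderiv ℝ (fun z => Real.log (u z)) (Real.cos a • m + Real.sin a • e)
          (-Real.sin a • m + Real.cos a • e) +
        fderiv ℝ (fun z => Real.log (u z)) (Real.cos a • m - Real.sin a • e)
          (Real.sin a • m + Real.cos a • e) = D at hb hderiv
  generalize Real.cos a • m + Real.sin a • e = y at *
  generalize Real.cos a • m - Real.sin a • e = z at *
  have huy := hu_pos y hy1
  have huz := hu_pos z hz1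
  have huzy : u z ≤ u y := ((Real.log_lt_log_iff huz huy).1 hlog).le
  rw [show p - 1 = p - 2 + 1 by ring, Real.rpow_add_one huy.ne', Real.rpow_add_one huz.ne',
    ← mul_assoc, ← mul_assoc, mul_div_cancel_right₀ _ huy.ne',
    mul_div_cancel_right₀ _ huz.ne'] at hb
  have hpow : u z ^ (p - 2) ≤ u y ^ (p - 2) := Real.rpow_le_rpow huz.le huzy (by linarith)
  have hpow0 : 0 ≤ u y ^ (p - 2) := Real.rpow_nonneg huy.le _
  have h1 : -(S * (2 * a)) * u y ^ (p - 2) ≤ f y * u y ^ (p - 2) - f z * u z ^ (p - 2) := by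
    have e1 := mul_le_mul_of_nonneg_right (neg_le_of_abs_le hfl) hpow0
    have e2 := mul_le_mul_of_nonneg_left hpow (hf_pos z hz1).le
    linarith
  have h2 : -(S * (2 * a)) * (k + 1) ≤
      f xf * (f y * u y ^ (p - 2) - f z * u z ^ (p - 2)) := by
    have e1 := mul_le_mul_of_nonneg_left h1 hM.le
    have e2 := mul_le_mul_of_nonneg_left hby (by positivity : 0 ≤ S * (2 * a))
    linarith
  have h3 := mul_le_mul_of_nonneg_left h2 hc.le
  have h4 : f xf * (k * (Real.sin a * (2 * C))) < f xf * (k * (Real.sin a * D)) := by gcongr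
  have h5 := mul_nonpos_of_nonneg_of_nonpos hM.le hb
  have h6 : Real.cos a * a ≤ Real.sin a := by
    have := Real.le_tan ha0.le ha1
    rw [Real.tan_eq_sin_div_cos, le_div_iff₀ hc] at this
    linarith
  have h7 := mul_le_mul_of_nonneg_left h6 (by positivity : 0 ≤ 2 * ((k + 1) * S))
  have h8 : f xf * (k * (Real.sin a * (2 * C))) = 2 * ((k + 1) * S) * Real.sin a := by
    linear_combination 2 * Real.sin a * hCk
  linarith
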